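/- arXiv:2307.03947 — 3 statements merged into one kernel-verified Lean document; each statement's English description precedes it below -/
import Mathlib

section
/- In the complete local ring Ô of a hyperelliptic Gorenstein contraction at an ℓ-branched point, the intersection of the principal ideal generated by s₁ with the ideal generated by s₂, …, s_ℓ is the zero ideal of Ô. -/
noncomputable section

/-- Index set for the variables `u₂, …, u_ℓ`. -/
abbrev Uix (ℓ : ℕ) [NeZero ℓ] : Type := {i : Fin ℓ // i ≠ 0}

/-- The ambient ring `K[[s₁,…,s_ℓ]][u₂,…,u_ℓ]`. -/
abbrev Amb (K : Type) [Field K] (ℓ : ℕ) [NeZero ℓ] : Type :=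
  MvPolynomial (Uix ℓ) (MvPowerSeries (Fin ℓ) K)

/-- The element `s_i` of the ambient ring. -/
def sv (K : Type) [Field K] (ℓ : ℕ) [NeZero ℓ] (i : Fin ℓ) : Amb K ℓ :=
  MvPolynomial.C (MvPowerSeries.X i)

/-- The element `u_i` of the ambient ring. -/
def uv (K : Type) [Field K] (ℓ : ℕ) [NeZero ℓ] (i : Uix ℓ) : Amb K ℓ :=
  MvPolynomial.X i

/-- The generators of the ideal `I` defining the complete local ring `Ô` of the
hyperelliptic Gorenstein contraction at an `ℓ`-branched point. -/
def Igens (K : Type) [Field K] (ℓ : ℕ) [NeZero ℓ] (m δ : Fin ℓ → ℕ) : Set (Amb K ℓ) :=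
  { p | (∃ i j : Fin ℓ, i < j ∧ p = sv K ℓ i * sv K ℓ j)
      ∨ (∃ i j : Uix ℓ, (i : Fin ℓ) < (j : Fin ℓ) ∧ p = sv K ℓ 0 * (uv K ℓ i - uv K ℓ j))
      ∨ (∃ i j : Uix ℓ, i ≠ j ∧ p = sv K ℓ (i : Fin ℓ) * uv K ℓ j)
      ∨ (∃ i : Uix ℓ, p = uv K ℓ i ^ 2 - (δ 0 : Amb K ℓ) * sv K ℓ 0 ^ m 0
            - (δ (i : Fin ℓ) : Amb K ℓ) * sv K ℓ (i : Fin ℓ) ^ m (i : Fin ℓ))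
      ∨ (∃ i j : Uix ℓ, (i : Fin ℓ) < (j : Fin ℓ) ∧
            p = uv K ℓ i * uv K ℓ j - (δ 0 : Amb K ℓ) * sv K ℓ 0 ^ m 0) }

/-- A power series lies in the ideal generated by the variables indexed by a finite set `s` as soon
as its coefficients at all monomials not involving these variables vanish. -/
theorem MvPowerSeries.mem_span_X_of_coeff_eq_zero {σ R : Type*} [CommRing R]
    (s : Finset σ) (f : MvPowerSeries σ R)
    (h : ∀ d : σ →₀ ℕ, (∀ i ∈ s, d i = 0) → MvPowerSeries.coeff d f = 0) :
    f ∈ Ideal.span ((MvPowerSeries.X : σ → MvPowerSeries σ R) '' (s : Set σ)) := by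
  classical
  induction s using Finset.induction_on generalizing f with
  | empty =>
    have hf : f = 0 := by
      ext d
      simpa using h d (by simp)
    simp [hf]
  | insert a s _ ih =>
    let g : MvPowerSeries σ R := fun d => if d a = 0 then MvPowerSeries.coeff d f else 0
    have hg : ∀ d, MvPowerSeries.coeff d g = if d a = 0 then MvPowerSeries.coeff d f else 0 :=
      fun _ => rfl
    have hdvd : MvPowerSeries.X a ∣ f - g := by
      rw [MvPowerSeries.X_dvd_iff]
      intro d hd
      simp [hg, hd]
    have hgs : g ∈ Ideal.span ((MvPowerSeries.X : σ → MvPowerSeries σ R) '' (s : Set σ)) := by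
      refine ih g fun d hd => ?_
      rw [hg]
      split_ifs with hda
      · exact h d (by simpa [hda] using hd)
      · rfl
    rw [← sub_add_cancel f g]
    refine add_mem (Ideal.mem_of_dvd _ hdvd (Ideal.subset_span ⟨a, by simp, rfl⟩)) ?_
    exact Ideal.span_mono (Set.image_mono (by simp)) hgs

theorem MvPowerSeries.mem_span_X_iff {σ R : Type*} [CommRing R]
    (s : Finset σ) (f : MvPowerSeries σ R) :
    f ∈ Ideal.span ((MvPowerSeries.X : σ → MvPowerSeries σ R) '' (s : Set σ)) ↔
      ∀ d : σ →₀ ℕ, (∀ i ∈ s, d i = 0) → MvPowerSeries.coeff d f = 0 := by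
  refine ⟨fun hf => ?_, MvPowerSeries.mem_span_X_of_coeff_eq_zero s f⟩
  induction hf using Submodule.span_induction with
  | mem x hx =>
    obtain ⟨i, hi, rfl⟩ := hx
    exact fun d hd => MvPowerSeries.X_dvd_iff.1 dvd_rfl d (hd i hi)
  | zero => simp
  | add x y _ _ hx hy => exact fun d hd => by rw [map_add, hx d hd, hy d hd, add_zero]
  | smul a x _ hx =>
    classical
    intro d hd
    rw [smul_eq_mul, MvPowerSeries.coeff_mul]
    refine Finset.sum_eq_zero fun p hp => ?_
    have hpd := Finset.HasAntidiagonal.mem_antidiagonal.1 hp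
    rw [hx p.2 fun i hi => ?_, mul_zero]
    have := DFunLike.congr_fun hpd i
    rw [Finsupp.add_apply, hd i hi] at this
    omega

/-- A variable outside of `s` is regular modulo the ideal generated by the variables in `s`. -/
theorem MvPowerSeries.isSMulRegular_mk_X {σ R : Type*} [CommRing R]
    (s : Finset σ) {a : σ} (ha : a ∉ s) :
    let P := Ideal.span ((MvPowerSeries.X : σ → MvPowerSeries σ R) '' (s : Set σ))
    IsSMulRegular (MvPowerSeries σ R ⧸ P) (Ideal.Quotient.mk P (MvPowerSeries.X a)) := by
  classical
  intro P
  rw [isSMulRegular_iff_right_eq_zero_of_smul]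
  intro x hx
  obtain ⟨f, rfl⟩ := Ideal.Quotient.mk_surjective x
  rw [smul_eq_mul, ← map_mul, Ideal.Quotient.eq_zero_iff_mem,
    MvPowerSeries.mem_span_X_iff] at hx
  rw [Ideal.Quotient.eq_zero_iff_mem, MvPowerSeries.mem_span_X_iff]
  intro d hd
  have := hx (Finsupp.single a 1 + d) fun i hi => by
    have hai : a ≠ i := fun h => ha (h ▸ hi)
    simp [hd i hi, hai]
  rwa [MvPowerSeries.X, MvPowerSeries.coeff_add_monomial_mul, one_mul] at this

/-- An element which is regular on `R` is regular on `R[X] / (p)` for a monic polynomial `p`. -/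
theorem IsSMulRegular.adjoinRoot {R : Type*} [CommRing R] {a : R} (ha : IsSMulRegular R a)
    {p : Polynomial R} (hp : p.Monic) : IsSMulRegular (AdjoinRoot p) a := by
  have : Module.Free R (AdjoinRoot p) := hp.free_adjoinRoot
  exact Module.Flat.isSMulRegular_of_isRegular (isLeftRegular_iff_isRegular.1 ha.isLeftRegular)

section Branch

open Polynomial

variable (K : Type) [Field K] (ℓ : ℕ) [NeZero ℓ] (m δ : Fin ℓ → ℕ)

/-- The ideal `(s₂, …, s_ℓ)` of the power series ring `K[[s₁, …, s_ℓ]]`. -/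
def tailIdeal : Ideal (MvPowerSeries (Fin ℓ) K) :=
  Ideal.span (MvPowerSeries.X '' ((Finset.univ.erase 0 : Finset (Fin ℓ)) : Set (Fin ℓ)))

/-- The power series ring `K[[s₁]]`, as a quotient of `K[[s₁, …, s_ℓ]]`. -/
abbrev BranchBase : Type := MvPowerSeries (Fin ℓ) K ⧸ tailIdeal K ℓ

/-- The element `s₁` of `K[[s₁]]`. -/
def branchParam : BranchBase K ℓ := Ideal.Quotient.mk _ (MvPowerSeries.X 0)

/-- The equation `u² - δ₁ s₁^{m₁}` of the double cover of the first branch. -/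
def branchPoly : (BranchBase K ℓ)[X] :=
  X ^ 2 - C ((δ 0 : BranchBase K ℓ) * branchParam K ℓ ^ m 0)

/-- The ring `K[[s₁]][u] / (u² - δ₁ s₁^{m₁})` of the double cover of the first branch. -/
abbrev BranchRing : Type := AdjoinRoot (branchPoly K ℓ m δ)

/-- The map to the ring of the first branch with `s_i ↦ 0` for `i ≠ 1` and `u_i ↦ u`. -/
def toBranch : Amb K ℓ →+* BranchRing K ℓ m δ :=
  MvPolynomial.eval₂Hom ((AdjoinRoot.of _).comp (Ideal.Quotient.mk _))
    fun _ => AdjoinRoot.root _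

theorem toBranch_uv (i : Uix ℓ) :
    toBranch K ℓ m δ (uv K ℓ i) = AdjoinRoot.root (branchPoly K ℓ m δ) := by
  simp [toBranch, uv]

theorem toBranch_sv_zero :
    toBranch K ℓ m δ (sv K ℓ 0) = AdjoinRoot.of (branchPoly K ℓ m δ) (branchParam K ℓ) := by
  simp [toBranch, sv, branchParam]

theorem X_mem_tailIdeal {i : Fin ℓ} (hi : i ≠ 0) : MvPowerSeries.X i ∈ tailIdeal K ℓ :=
  Ideal.subset_span ⟨i, by simp [hi], rfl⟩

theorem toBranch_sv {i : Fin ℓ} (hi : i ≠ 0) : toBranch K ℓ m δ (sv K ℓ i) = 0 := by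
  simp [toBranch, sv, Ideal.Quotient.eq_zero_iff_mem.2 (X_mem_tailIdeal K ℓ hi)]

theorem root_branchPoly_sq :
    AdjoinRoot.root (branchPoly K ℓ m δ) ^ 2 =
      (δ 0 : BranchRing K ℓ m δ) * AdjoinRoot.of _ (branchParam K ℓ) ^ m 0 := by
  have h := AdjoinRoot.eval₂_root (branchPoly K ℓ m δ)
  have hpoly : branchPoly K ℓ m δ =
    X ^ 2 - C ((δ 0 : BranchBase K ℓ) * branchParam K ℓ ^ m 0) := rfl
  conv at h => enter [1, 3]; rw [hpoly]
  simpa [sub_eq_zero, eval₂_mul, eval₂_pow] using h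

theorem isSMulRegular_branchParam :
    IsSMulRegular (BranchRing K ℓ m δ) (branchParam K ℓ) := by
  exact (MvPowerSeries.isSMulRegular_mk_X (Finset.univ.erase 0) (by simp)).adjoinRoot
    (monic_X_pow_sub_C _ two_ne_zero)

/-- A ring homomorphism compatible with the relations of the first branch factors through its
ring. -/
theorem map_eq_zero_of_toBranch_eq_zero {S : Type*} [CommRing S] (q : Amb K ℓ →+* S) (i₀ : Uix ℓ)
    (hs : ∀ i ≠ 0, q (sv K ℓ i) = 0) (hu : ∀ i, q (uv K ℓ i) = q (uv K ℓ i₀))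
    (hsq : q (uv K ℓ i₀) ^ 2 = δ 0 * q (sv K ℓ 0) ^ m 0) {f : Amb K ℓ}
    (hf : toBranch K ℓ m δ f = 0) : q f = 0 := by
  have htail : ∀ a ∈ tailIdeal K ℓ, q.comp MvPolynomial.C a = 0 := by
    suffices tailIdeal K ℓ ≤ RingHom.ker (q.comp MvPolynomial.C) from fun a ha => this ha
    rw [tailIdeal, Ideal.span_le]
    rintro _ ⟨i, hi, rfl⟩
    exact hs i (by simpa using hi)
  let base : BranchBase K ℓ →+* S := Ideal.Quotient.lift _ _ htail
  have hbase : base (branchParam K ℓ) = q (sv K ℓ 0) := rfl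
  have hroot : (branchPoly K ℓ m δ).eval₂ base (q (uv K ℓ i₀)) = 0 := by
    rw [branchPoly, eval₂_sub, eval₂_X_pow, eval₂_C, map_mul, map_pow, map_natCast, hbase, hsq,
      sub_self]
  let back : BranchRing K ℓ m δ →+* S := AdjoinRoot.lift base _ hroot
  have hcomp : back.comp (toBranch K ℓ m δ) = q := by
    refine MvPolynomial.ringHom_ext (fun a => ?_) fun i => ?_
    · simp [back, toBranch, base]
    · change back (toBranch K ℓ m δ (uv K ℓ i)) = q (uv K ℓ i)
      rw [toBranch_uv, AdjoinRoot.lift_root, hu i]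
  rw [← hcomp, RingHom.comp_apply, hf, map_zero]

variable {m}

theorem toBranch_eq_zero_of_mem (hm : ∀ i, 0 < m i) {f : Amb K ℓ}
    (hf : f ∈ Ideal.span (Igens K ℓ m δ)) : toBranch K ℓ m δ f = 0 := by
  suffices Ideal.span (Igens K ℓ m δ) ≤ RingHom.ker (toBranch K ℓ m δ) from this hf
  rw [Ideal.span_le]
  rintro p (⟨i, j, hij, rfl⟩ | ⟨i, j, -, rfl⟩ | ⟨i, j, -, rfl⟩ | ⟨i, rfl⟩ | ⟨i, j, -, rfl⟩) <;>
    rw [SetLike.mem_coe, RingHom.mem_ker]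
  · have hj : j ≠ 0 := ne_of_gt (lt_of_le_of_lt (Fin.zero_le i) hij)
    rw [map_mul, toBranch_sv K ℓ m δ hj, mul_zero]
  · simp [toBranch_uv]
  · rw [map_mul, toBranch_sv K ℓ m δ i.2, zero_mul]
  · simp [toBranch_uv, toBranch_sv_zero, toBranch_sv K ℓ m δ i.2, root_branchPoly_sq,
      (hm _).ne']
  · simp [toBranch_uv, toBranch_sv_zero, ← root_branchPoly_sq, sq]

theorem sv_zero_mul_sv_mem {i : Fin ℓ} (hi : i ≠ 0) :
    sv K ℓ 0 * sv K ℓ i ∈ Ideal.span (Igens K ℓ m δ) :=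
  Ideal.subset_span (Or.inl ⟨0, i, Fin.pos_iff_ne_zero.2 hi, rfl⟩)

theorem sv_zero_mul_uv_sub_uv_mem (i j : Uix ℓ) :
    sv K ℓ 0 * (uv K ℓ i - uv K ℓ j) ∈ Ideal.span (Igens K ℓ m δ) := by
  rcases lt_trichotomy (i : Fin ℓ) j with h | h | h
  · exact Ideal.subset_span (Or.inr (Or.inl ⟨i, j, h, rfl⟩))
  · simp [Subtype.ext h]
  · have hgen : sv K ℓ 0 * (uv K ℓ j - uv K ℓ i) ∈ Ideal.span (Igens K ℓ m δ) :=
      Ideal.subset_span (Or.inr (Or.inl ⟨j, i, h, rfl⟩))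
    convert neg_mem hgen using 1
    ring

theorem sv_zero_mul_uv_sq_sub_mem (hm : ∀ i, 0 < m i) (i : Uix ℓ) :
    sv K ℓ 0 * (uv K ℓ i ^ 2 - (δ 0 : Amb K ℓ) * sv K ℓ 0 ^ m 0) ∈
      Ideal.span (Igens K ℓ m δ) := by
  have hgen : uv K ℓ i ^ 2 - (δ 0 : Amb K ℓ) * sv K ℓ 0 ^ m 0 - (δ i : Amb K ℓ) *
      sv K ℓ i ^ m i ∈ Ideal.span (Igens K ℓ m δ) :=
    Ideal.subset_span (Or.inr (Or.inr (Or.inr (Or.inl ⟨i, rfl⟩))))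
  obtain ⟨k, hk⟩ := Nat.exists_eq_add_one.2 (hm i)
  rw [hk] at hgen
  convert add_mem (Ideal.mul_mem_left _ (sv K ℓ 0) hgen)
    (Ideal.mul_mem_left _ ((δ i : Amb K ℓ) * sv K ℓ i ^ k)
      (sv_zero_mul_sv_mem (m := m) K ℓ δ i.2)) using 1
  ring

/-- The kernel of the map to the first branch is annihilated by `s₁` in `Ô`. -/
theorem sv_zero_mul_mem_of_toBranch_eq_zero (hm : ∀ i, 0 < m i) (i₀ : Uix ℓ) {f : Amb K ℓ}
    (hf : toBranch K ℓ m δ f = 0) : sv K ℓ 0 * f ∈ Ideal.span (Igens K ℓ m δ) := by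
  let J : Ideal (Amb K ℓ) :=
    Submodule.comap (LinearMap.mulLeft (Amb K ℓ) (sv K ℓ 0)) (Ideal.span (Igens K ℓ m δ))
  have hJ : ∀ {g}, g ∈ J ↔ sv K ℓ 0 * g ∈ Ideal.span (Igens K ℓ m δ) := Iff.rfl
  rw [← hJ, ← Ideal.Quotient.eq_zero_iff_mem]
  refine map_eq_zero_of_toBranch_eq_zero (S := Amb K ℓ ⧸ J) K ℓ m δ (Ideal.Quotient.mk J) i₀
    (fun i hi => Ideal.Quotient.eq_zero_iff_mem.2 (hJ.2 (sv_zero_mul_sv_mem K ℓ δ hi)))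
    (fun i => Ideal.Quotient.eq.2 (hJ.2 (sv_zero_mul_uv_sub_uv_mem K ℓ δ i i₀))) ?_ hf
  rw [← map_natCast (Ideal.Quotient.mk J), ← map_pow, ← map_pow, ← map_mul]
  exact Ideal.Quotient.eq.2 (hJ.2 (sv_zero_mul_uv_sq_sub_mem K ℓ δ hm i₀))

end Branch

/-- In `Ô`, the intersection of the principal ideal generated by `s₁`
with the ideal generated by `s₂, …, s_ℓ` is the zero ideal. -/
theorem statement4 (K : Type) [Field K] (hchar : (2 : K) ≠ 0) (n : ℕ)
    (m δ : Fin (n + 2) → ℕ) (hm : ∀ i, 0 < m i) (hδ : ∀ i, δ i = 0 ∨ δ i = 1) :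
    ∀ (I : Ideal (Amb K (n + 2))), I = Ideal.span (Igens K (n + 2) m δ) →
    (Ideal.span {Ideal.Quotient.mk I (sv K (n + 2) 0)} ⊓
      Ideal.span { x | ∃ i : Fin (n + 2), i ≠ 0 ∧
          x = Ideal.Quotient.mk I (sv K (n + 2) i) }) = ⊥ := by
  rintro I rfl
  refine (Submodule.eq_bot_iff _).2 fun x hx => ?_
  obtain ⟨hx₁, hx₂⟩ := Submodule.mem_inf.1 hx
  obtain ⟨y, rfl⟩ := Ideal.mem_span_singleton'.1 hx₁
  obtain ⟨f, rfl⟩ := Ideal.Quotient.mk_surjective y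
  let φ : Amb K (n + 2) ⧸ Ideal.span (Igens K (n + 2) m δ) →+* BranchRing K (n + 2) m δ :=
    Ideal.Quotient.lift _ (toBranch K (n + 2) m δ)
      fun _ => toBranch_eq_zero_of_mem K (n + 2) δ hm
  have hker : Ideal.span { x | ∃ i : Fin (n + 2), i ≠ 0 ∧ x = Ideal.Quotient.mk
      (Ideal.span (Igens K (n + 2) m δ)) (sv K (n + 2) i) } ≤ RingHom.ker φ := by
    rw [Ideal.span_le]
    rintro _ ⟨i, hi, rfl⟩
    exact toBranch_sv K (n + 2) m δ hi
  have hφ : toBranch K (n + 2) m δ (f * sv K (n + 2) 0) = 0 := hker hx₂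
  rw [map_mul, toBranch_sv_zero, mul_comm, ← AdjoinRoot.algebraMap_eq, ← Algebra.smul_def] at hφ
  have hf := (isSMulRegular_branchParam K (n + 2) m δ).right_eq_zero_of_smul hφ
  rw [← map_mul, Ideal.Quotient.eq_zero_iff_mem, mul_comm]
  exact sv_zero_mul_mem_of_toBranch_eq_zero K (n + 2) δ hm ⟨1, one_ne_zero⟩ hf
end
end

section
/- Let K be a field of characteristic different from 2. There is a K-algebra isomorphism from K[[x₁, x₂, x₃]]/(x₁x₃ − x₂x₃, x₁x₂ − x₃³) to K[[s₁, s₂]][u]/(s₁s₂, u² − s₁² − s₂³) sending x₁ ↦ u + s₁, x₂ ↦ u − s₁, and x₃ ↦ s₂. (This identifies the singularity produced by the Gorenstein contraction of a hyperelliptic admissible cover with contracted middle component — a genus-two singularity 'of type I' with three branches — with the singularity k[[x₁, x̄₁, x₂]]/(x₁x₂ − x̄₁x₂, x₁x̄₁ − x₂³) of Battistella's classification.) -/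
noncomputable section

open scoped Polynomial PowerSeries

/-- The linear change of variables `x₀ ↦ x₀ + x₁`, `x₁ ↦ x₀ - x₁`, `x₂ ↦ x₂`. -/
def sumDiffVars (K : Type) [Field K] : Fin 3 → MvPowerSeries (Fin 3) K :=
  ![MvPowerSeries.X 0 + MvPowerSeries.X 1, MvPowerSeries.X 0 - MvPowerSeries.X 1,
    MvPowerSeries.X 2]

/-- The linear change of variables inverse to `sumDiffVars`. -/
def halfSumDiffVars (K : Type) [Field K] : Fin 3 → MvPowerSeries (Fin 3) K :=
  ![(2⁻¹ : K) • (MvPowerSeries.X 0 + MvPowerSeries.X 1),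
    (2⁻¹ : K) • (MvPowerSeries.X 0 - MvPowerSeries.X 1), MvPowerSeries.X 2]

lemma hasSubst_sumDiffVars (K : Type) [Field K] : MvPowerSeries.HasSubst (sumDiffVars K) :=
  MvPowerSeries.hasSubst_of_constantCoeff_zero fun i ↦ by
    fin_cases i <;> simp [sumDiffVars]

lemma hasSubst_halfSumDiffVars (K : Type) [Field K] :
    MvPowerSeries.HasSubst (halfSumDiffVars K) :=
  MvPowerSeries.hasSubst_of_constantCoeff_zero fun i ↦ by
    fin_cases i <;> simp [halfSumDiffVars, MvPowerSeries.smul_eq_C_mul]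

lemma inv_two_smul_add_self {K M : Type*} [Field K] [AddCommGroup M] [Module K M]
    (h : (2 : K) ≠ 0) (x : M) : (2⁻¹ : K) • (x + x) = x := by
  rw [← two_smul K, smul_smul, inv_mul_cancel₀ h, one_smul]

lemma MvPowerSeries.substAlgHom_comp_eq_id {σ R : Type*} [CommRing R]
    {a b : σ → MvPowerSeries σ R} (ha : HasSubst a) (hb : HasSubst b)
    (h : ∀ i, substAlgHom (R := R) hb (a i) = X i) :
    (substAlgHom (R := R) hb).comp (substAlgHom ha) = AlgHom.id R _ := by
  ext1 f
  have hX : (fun i ↦ substAlgHom (R := R) hb (a i)) = X := funext h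
  rw [AlgHom.comp_apply, substAlgHom_comp_substAlgHom_apply, substAlgHom_apply, hX, subst_self]
  rfl

/-- The automorphism of `K[[x₀, x₁, x₂]]` given by `sumDiffVars`. -/
def sumDiffEquiv (K : Type) [Field K] (h : (2 : K) ≠ 0) :
    MvPowerSeries (Fin 3) K ≃ₐ[K] MvPowerSeries (Fin 3) K :=
  AlgEquiv.ofAlgHom (MvPowerSeries.substAlgHom (hasSubst_sumDiffVars K))
    (MvPowerSeries.substAlgHom (hasSubst_halfSumDiffVars K))
    (by
      refine MvPowerSeries.substAlgHom_comp_eq_id _ _ fun i ↦ ?_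
      have hs := MvPowerSeries.substAlgHom_X (R := K) (hasSubst_sumDiffVars K)
      generalize MvPowerSeries.substAlgHom (R := K) (hasSubst_sumDiffVars K) = φ at hs
      fin_cases i <;>
        simp [halfSumDiffVars, hs, sumDiffVars, -smul_add, inv_two_smul_add_self h])
    (by
      refine MvPowerSeries.substAlgHom_comp_eq_id _ _ fun i ↦ ?_
      have hs := MvPowerSeries.substAlgHom_X (R := K) (hasSubst_halfSumDiffVars K)
      generalize MvPowerSeries.substAlgHom (R := K) (hasSubst_halfSumDiffVars K) = φ at hs
      fin_cases i <;>
        simp [halfSumDiffVars, hs, sumDiffVars, ← smul_add, ← smul_sub,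
          inv_two_smul_add_self h])

lemma sumDiffEquiv_X (K : Type) [Field K] (h : (2 : K) ≠ 0) (i : Fin 3) :
    sumDiffEquiv K h (MvPowerSeries.X i) = sumDiffVars K i :=
  MvPowerSeries.substAlgHom_X (hasSubst_sumDiffVars K) i

/-- The isomorphism `K[[x₁, x₂, x₃]] ≃ K[[s₁, s₂]][[u]]` sending `x₁ ↦ u + s₁`, `x₂ ↦ u - s₁`
and `x₃ ↦ s₂`. -/
def branchEquiv (K : Type) [Field K] (h : (2 : K) ≠ 0) :
    MvPowerSeries (Fin 3) K ≃ₐ[K] PowerSeries (MvPowerSeries (Fin 2) K) :=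
  (sumDiffEquiv K h).trans (MvPowerSeries.finSuccEquiv K 2)

lemma branchEquiv_X_zero (K : Type) [Field K] (h : (2 : K) ≠ 0) :
    branchEquiv K h (MvPowerSeries.X 0) =
      PowerSeries.X + PowerSeries.C (MvPowerSeries.X 0) := by
  have h1 := MvPowerSeries.finSuccEquiv_X_succ (R := K) (n := 2) 0
  simp only [Fin.succ_zero_eq_one] at h1
  simp [branchEquiv, sumDiffEquiv_X, sumDiffVars, h1]

lemma branchEquiv_X_one (K : Type) [Field K] (h : (2 : K) ≠ 0) :
    branchEquiv K h (MvPowerSeries.X 1) =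
      PowerSeries.X - PowerSeries.C (MvPowerSeries.X 0) := by
  have h1 := MvPowerSeries.finSuccEquiv_X_succ (R := K) (n := 2) 0
  simp only [Fin.succ_zero_eq_one] at h1
  simp [branchEquiv, sumDiffEquiv_X, sumDiffVars, h1]

lemma branchEquiv_X_two (K : Type) [Field K] (h : (2 : K) ≠ 0) :
    branchEquiv K h (MvPowerSeries.X 2) = PowerSeries.C (MvPowerSeries.X 1) := by
  have h1 := MvPowerSeries.finSuccEquiv_X_succ (R := K) (n := 2) 1
  simp only [Fin.succ_one_eq_two] at h1
  simp [branchEquiv, sumDiffEquiv_X, sumDiffVars, h1]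

/-- For a distinguished polynomial `g`, every power series is congruent modulo `g` to a
polynomial. -/
lemma Polynomial.IsDistinguishedAt.exists_polynomial_add_mul {A : Type*} [CommRing A]
    {I : Ideal A} [IsAdicComplete I A] {g : A[X]} (H : g.IsDistinguishedAt I) (f : A⟦X⟧) :
    ∃ (r : A[X]) (q : A⟦X⟧), f = r + q * g := by
  have := H.isWeierstrassDivisorAt'.isWeierstrassDivisionAt_div_mod f
  exact ⟨_, _, by rw [mul_comm, add_comm]; exact this.eq_mul_add⟩

/-- A polynomial divisible by a distinguished polynomial as a power series is divisible by it as
a polynomial. -/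
lemma Polynomial.IsDistinguishedAt.mem_span_of_coe_mem_span {A : Type*} [CommRing A]
    {I : Ideal A} [IsAdicComplete I A] {g : A[X]} (H : g.IsDistinguishedAt I) {p : A[X]}
    (hp : (p : A⟦X⟧) ∈ Ideal.span {(g : A⟦X⟧)}) : p ∈ Ideal.span {g} := by
  rw [← Ideal.Quotient.eq_zero_iff_mem] at hp ⊢
  apply H.algEquivQuotient.injective
  rw [map_zero, ← hp]
  simp

/-- For a distinguished polynomial `g`, the inclusion `A[X] → A⟦X⟧` induces an isomorphism modulo
`(t, g)`. -/
lemma Polynomial.IsDistinguishedAt.exists_algEquiv_quotient_pair {k A : Type*} [CommRing k]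
    [CommRing A] [Algebra k A] {I : Ideal A} [IsAdicComplete I A] {g : A[X]}
    (H : g.IsDistinguishedAt I) (t : A[X]) :
    ∃ e : (A[X] ⧸ Ideal.span {t, g}) ≃ₐ[k]
        (A⟦X⟧ ⧸ Ideal.span {(t : A⟦X⟧), (g : A⟦X⟧)}),
      ∀ p : A[X], e (Ideal.Quotient.mk _ p) = Ideal.Quotient.mk _ (p : A⟦X⟧) := by
  let ι : A[X] →ₐ[k] A⟦X⟧ := (Polynomial.coeToPowerSeries.algHom A).restrictScalars k
  have hι (p : A[X]) : ι p = (p : A⟦X⟧) := by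
    simp [ι, Polynomial.coeToPowerSeries.algHom_apply]
  have hle : Ideal.span {t, g} ≤
      (Ideal.span {(t : A⟦X⟧), (g : A⟦X⟧)}).comap ι := by
    rw [Ideal.span_le]
    rintro x (rfl | rfl)
    · exact Ideal.subset_span (by simp [hι])
    · exact Ideal.subset_span (by simp [hι])
  refine ⟨AlgEquiv.ofBijective (Ideal.quotientMapₐ _ ι hle) ⟨?_, ?_⟩, fun p ↦ ?_⟩
  · rw [injective_iff_map_eq_zero]
    intro x hx
    obtain ⟨p, rfl⟩ := Ideal.Quotient.mk_surjective x
    replace hx : Ideal.Quotient.mk (Ideal.span {(t : A⟦X⟧), (g : A⟦X⟧)}) (ι p) = 0 := hx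
    rw [Ideal.Quotient.eq_zero_iff_mem, hι, Ideal.mem_span_pair] at hx
    obtain ⟨a, b, hab⟩ := hx
    obtain ⟨r, q, rfl⟩ := H.exists_polynomial_add_mul a
    have hmem : p - r * t ∈ Ideal.span {g} := by
      apply H.mem_span_of_coe_mem_span
      rw [Ideal.mem_span_singleton']
      refine ⟨q * t + b, ?_⟩
      rw [Polynomial.coe_sub, Polynomial.coe_mul, ← hab]
      ring
    obtain ⟨c, hc⟩ := Ideal.mem_span_singleton'.1 hmem
    rw [Ideal.Quotient.eq_zero_iff_mem, Ideal.mem_span_pair]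
    exact ⟨r, c, by rw [hc]; ring⟩
  · intro y
    obtain ⟨f, rfl⟩ := Ideal.Quotient.mk_surjective y
    obtain ⟨r, q, rfl⟩ := H.exists_polynomial_add_mul f
    refine ⟨Ideal.Quotient.mk _ r, ?_⟩
    change Ideal.Quotient.mk _ (ι r) = _
    rw [Ideal.Quotient.mk_eq_mk_iff_sub_mem, hι, Ideal.mem_span_pair]
    exact ⟨0, -q, by ring⟩
  · change Ideal.Quotient.mk _ (ι p) = _
    rw [hι]

lemma isDistinguishedAt_X_sq_sub {A : Type*} [CommRing A] {I : Ideal A} {c : A} (hc : c ∈ I) :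
    (Polynomial.X ^ 2 - Polynomial.C c : A[X]).IsDistinguishedAt I where
  mem {n} hn := by
    nontriviality A
    rw [Polynomial.natDegree_X_pow_sub_C] at hn
    rw [Polynomial.coeff_sub, Polynomial.coeff_X_pow, Polynomial.coeff_C, if_neg hn.ne]
    split_ifs <;> simp [hc]
  monic := Polynomial.monic_X_pow_sub_C c two_ne_zero

/-- There is a `K`-algebra isomorphism
`K[[x₁,x₂,x₃]]/(x₁x₃ - x₂x₃, x₁x₂ - x₃³) ≃ K[[s₁,s₂]][u]/(s₁s₂, u² - s₁² - s₂³)`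
sending `x₁ ↦ u + s₁`, `x₂ ↦ u - s₁` and `x₃ ↦ s₂`. -/
theorem statement9 (K : Type) [Field K] (hchar : (2 : K) ≠ 0) :
    ∀ (I : Ideal (MvPowerSeries (Fin 3) K)),
      I = Ideal.span {MvPowerSeries.X 0 * MvPowerSeries.X 2
            - MvPowerSeries.X 1 * MvPowerSeries.X 2,
          MvPowerSeries.X 0 * MvPowerSeries.X 1 - MvPowerSeries.X 2 ^ 3} →
    ∀ (J : Ideal (Polynomial (MvPowerSeries (Fin 2) K))),
      J = Ideal.span {Polynomial.C (MvPowerSeries.X 0 * MvPowerSeries.X 1),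
          Polynomial.X ^ 2 - Polynomial.C (MvPowerSeries.X 0) ^ 2
            - Polynomial.C (MvPowerSeries.X 1) ^ 3} →
    ∃ e : (MvPowerSeries (Fin 3) K ⧸ I) ≃ₐ[K]
        (Polynomial (MvPowerSeries (Fin 2) K) ⧸ J),
      e (Ideal.Quotient.mk I (MvPowerSeries.X 0))
        = Ideal.Quotient.mk J (Polynomial.X + Polynomial.C (MvPowerSeries.X 0)) ∧
      e (Ideal.Quotient.mk I (MvPowerSeries.X 1))
        = Ideal.Quotient.mk J (Polynomial.X - Polynomial.C (MvPowerSeries.X 0)) ∧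
      e (Ideal.Quotient.mk I (MvPowerSeries.X 2))
        = Ideal.Quotient.mk J (Polynomial.C (MvPowerSeries.X 1)) := by
  rintro I rfl J rfl
  have hg : (Polynomial.X ^ 2 - Polynomial.C (MvPowerSeries.X 0) ^ 2
      - Polynomial.C (MvPowerSeries.X 1) ^ 3 : (MvPowerSeries (Fin 2) K)[X]).IsDistinguishedAt
        (Ideal.span (Set.range MvPowerSeries.X)) := by
    have hX (i : Fin 2) : (MvPowerSeries.X i : MvPowerSeries (Fin 2) K) ∈
        Ideal.span (Set.range MvPowerSeries.X) := Ideal.subset_span ⟨i, rfl⟩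
    rw [sub_sub, ← map_pow, ← map_pow, ← map_add]
    exact isDistinguishedAt_X_sq_sub (add_mem (Ideal.pow_mem_of_mem _ (hX 0) 2 two_pos)
      (Ideal.pow_mem_of_mem _ (hX 1) 3 three_pos))
  obtain ⟨e, he⟩ := hg.exists_algEquiv_quotient_pair (k := K)
    (Polynomial.C (MvPowerSeries.X 0 * MvPowerSeries.X 1))
  have h2 : IsUnit (2 : PowerSeries (MvPowerSeries (Fin 2) K)) := by
    rw [← map_ofNat (algebraMap K (PowerSeries (MvPowerSeries (Fin 2) K))) 2]
    exact hchar.isUnit.map _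
  have hI := Ideal.map_span (branchEquiv K hchar)
    {MvPowerSeries.X 0 * MvPowerSeries.X 2 - MvPowerSeries.X 1 * MvPowerSeries.X 2,
      MvPowerSeries.X 0 * MvPowerSeries.X 1 - MvPowerSeries.X 2 ^ 3}
  rw [Set.image_pair] at hI
  simp only [map_sub, map_mul, map_pow, branchEquiv_X_zero, branchEquiv_X_one,
    branchEquiv_X_two] at hI
  have hJ : Ideal.span {((Polynomial.C (MvPowerSeries.X 0 * MvPowerSeries.X 1) :
        (MvPowerSeries (Fin 2) K)[X]) : PowerSeries (MvPowerSeries (Fin 2) K)),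
      ((Polynomial.X ^ 2 - Polynomial.C (MvPowerSeries.X 0) ^ 2
        - Polynomial.C (MvPowerSeries.X 1) ^ 3 : (MvPowerSeries (Fin 2) K)[X]) :
          PowerSeries (MvPowerSeries (Fin 2) K))} =
      Ideal.map (branchEquiv K hchar : MvPowerSeries (Fin 3) K →+* PowerSeries (MvPowerSeries (Fin 2) K))
        (Ideal.span {MvPowerSeries.X 0 * MvPowerSeries.X 2
            - MvPowerSeries.X 1 * MvPowerSeries.X 2,
          MvPowerSeries.X 0 * MvPowerSeries.X 1 - MvPowerSeries.X 2 ^ 3}) := by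
    refine Eq.trans ?_ hI.symm
    rw [Ideal.span_insert, Ideal.span_insert]
    congr 1
    · rw [← Ideal.span_singleton_mul_left_unit h2]
      congr 2
      rw [Polynomial.coe_C, map_mul]
      ring
    · congr 2
      simp only [Polynomial.coe_sub, Polynomial.coe_pow, Polynomial.coe_X, Polynomial.coe_C]
      ring
  refine ⟨(Ideal.quotientEquivAlg _ _ (branchEquiv K hchar) hJ).trans e.symm, ?_, ?_, ?_⟩
  · rw [AlgEquiv.trans_apply, AlgEquiv.symm_apply_eq, he]
    refine congrArg (Ideal.Quotient.mk _) (?_ : branchEquiv K hchar _ = _)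
    rw [branchEquiv_X_zero, Polynomial.coe_add, Polynomial.coe_X, Polynomial.coe_C]
  · rw [AlgEquiv.trans_apply, AlgEquiv.symm_apply_eq, he]
    refine congrArg (Ideal.Quotient.mk _) (?_ : branchEquiv K hchar _ = _)
    rw [branchEquiv_X_one, Polynomial.coe_sub, Polynomial.coe_X, Polynomial.coe_C]
  · rw [AlgEquiv.trans_apply, AlgEquiv.symm_apply_eq, he]
    refine congrArg (Ideal.Quotient.mk _) (?_ : branchEquiv K hchar _ = _)
    rw [branchEquiv_X_two, Polynomial.coe_C]
end
end

section
/- Let K be a field of characteristic different from 2. There is a K-algebra isomorphism from K[[x₁, x₂, y]]/(x₁x₂, (x₁ − x₂)y) to K[[s₁, s₂]][u]/(s₁s₂, u² − s₁²) sending x₁ ↦ u + s₁, x₂ ↦ u − s₁, and y ↦ s₂. (This identifies the singularity produced by the Gorenstein contraction in the genus-two ribbon example with the attaching singularity of a (2)-tailed ribbon.) -/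
noncomputable section

open MvPowerSeries in
theorem MvPowerSeries.HasSubst.update_X_zero {σ K : Type*} [Finite σ] [DecidableEq σ] [CommRing K]
    (s : σ) : HasSubst (Function.update X s (0 : MvPowerSeries σ K)) := by
  refine hasSubst_of_constantCoeff_zero fun i ↦ ?_
  by_cases hi : i = s
  · subst hi
    simp
  · simp [hi]

open MvPowerSeries in
theorem MvPowerSeries.X_dvd_sub_subst_update_zero {σ K : Type*} [Finite σ] [DecidableEq σ]
    [CommRing K] (s : σ) (f : MvPowerSeries σ K) :
    (X s : MvPowerSeries σ K) ∣ f - subst (Function.update X s (0 : MvPowerSeries σ K)) f := by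
  have ha := HasSubst.update_X_zero (K := K) s
  have hprod : ∀ d : σ →₀ ℕ, d s = 0 →
      (d.prod fun i n ↦ (Function.update X s (0 : MvPowerSeries σ K)) i ^ n) = monomial d 1 := by
    intro d hd
    rw [monomial_one_eq]
    refine Finsupp.prod_congr fun i hi ↦ ?_
    have : i ≠ s := by
      rintro rfl
      simp [hd] at hi
    simp [this]
  rw [X_dvd_iff]
  intro m hm
  rw [map_sub, coeff_subst ha, sub_eq_zero, finsum_eq_single _ m]
  · simp [hprod m hm]
  · intro d hd
    by_cases hds : d s = 0
    · rw [hprod d hds, coeff_monomial_ne hd.symm, smul_zero]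
    · have : (d.prod fun i n ↦ (Function.update X s (0 : MvPowerSeries σ K)) i ^ n) = 0 := by
        refine Finset.prod_eq_zero (i := s) (by simpa using hds) ?_
        simp [hds]
      rw [this, map_zero, smul_zero]

open MvPowerSeries in
/-- If the substitution `a` sends `X s` to zero, and some substitution `b` recovers the other
variables from their images, then `X s` divides every power series killed by `a`. -/
theorem MvPowerSeries.X_dvd_of_substAlgHom_eq_zero {σ τ K : Type*} [Finite σ] [CommRing K]
    {a : σ → MvPowerSeries τ K} (ha : HasSubst a) {b : τ → MvPowerSeries σ K} (hb : HasSubst b)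
    (s : σ) (hs : a s = 0) (hab : ∀ i ≠ s, substAlgHom (R := K) hb (a i) = X i)
    {f : MvPowerSeries σ K} (hf : substAlgHom (R := K) ha f = 0) : X s ∣ f := by
  classical
  have key := X_dvd_sub_subst_update_zero s f
  have : subst (Function.update X s (0 : MvPowerSeries σ K)) f = 0 := by
    have h1 := substAlgHom_comp_substAlgHom_apply ha hb f
    rw [hf, map_zero, substAlgHom_apply] at h1
    refine Eq.trans ?_ h1.symm
    congr 1
    funext i
    by_cases hi : i = s
    · subst hi
      rw [hs, map_zero, Function.update_self]
    · rw [Function.update_of_ne hi, hab i hi]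
  rwa [this, sub_zero] at key

/-- There is a `K`-algebra isomorphism
`K[[x₁,x₂,y]]/(x₁x₂, (x₁ - x₂)y) ≃ K[[s₁,s₂]][u]/(s₁s₂, u² - s₁²)`
sending `x₁ ↦ u + s₁`, `x₂ ↦ u - s₁` and `y ↦ s₂`. -/
theorem statement10 (K : Type) [Field K] (hchar : (2 : K) ≠ 0) :
    ∀ (I : Ideal (MvPowerSeries (Fin 3) K)),
      I = Ideal.span {MvPowerSeries.X 0 * MvPowerSeries.X 1,
          (MvPowerSeries.X 0 - MvPowerSeries.X 1) * MvPowerSeries.X 2} →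
    ∀ (J : Ideal (Polynomial (MvPowerSeries (Fin 2) K))),
      J = Ideal.span {Polynomial.C (MvPowerSeries.X 0 * MvPowerSeries.X 1),
          Polynomial.X ^ 2 - Polynomial.C (MvPowerSeries.X 0) ^ 2} →
    ∃ e : (MvPowerSeries (Fin 3) K ⧸ I) ≃ₐ[K]
        (Polynomial (MvPowerSeries (Fin 2) K) ⧸ J),
      e (Ideal.Quotient.mk I (MvPowerSeries.X 0))
        = Ideal.Quotient.mk J (Polynomial.X + Polynomial.C (MvPowerSeries.X 0)) ∧
      e (Ideal.Quotient.mk I (MvPowerSeries.X 1))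
        = Ideal.Quotient.mk J (Polynomial.X - Polynomial.C (MvPowerSeries.X 0)) ∧
      e (Ideal.Quotient.mk I (MvPowerSeries.X 2))
        = Ideal.Quotient.mk J (Polynomial.C (MvPowerSeries.X 1)) := by
  open MvPowerSeries in
  rintro I rfl J rfl
  set P := MvPowerSeries (Fin 3) K
  set R := MvPowerSeries (Fin 2) K
  set J : Ideal (Polynomial R) := Ideal.span {Polynomial.C (X 0 * X 1),
    Polynomial.X ^ 2 - Polynomial.C (X 0) ^ 2} with hJ
  set I : Ideal P := Ideal.span {X 0 * X 1, (X 0 - X 1) * X 2} with hI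
  let h : ∀ {S : Type} [CommRing S] [Algebra K S], S := fun {S} _ _ ↦ algebraMap K S 2⁻¹
  have hh : ∀ (S : Type) [CommRing S] [Algebra K S], 2 * (h : S) = 1 := fun S _ _ ↦ by
    simp only [h]
    rw [← map_ofNat (algebraMap K S) 2, ← map_mul, mul_inv_cancel₀ hchar, map_one]
  have hmap : ∀ {S T : Type} [CommRing S] [Algebra K S] [CommRing T] [Algebra K T]
      (φ : S →ₐ[K] T), φ h = h := fun φ ↦ φ.commutes _
  have ha₁ : HasSubst (![2 * X 0, 0, X 1] : Fin 3 → R) :=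
    hasSubst_of_constantCoeff_zero fun i ↦ by fin_cases i <;> simp
  have ha₂ : HasSubst (![0, -(2 * X 0), X 1] : Fin 3 → R) :=
    hasSubst_of_constantCoeff_zero fun i ↦ by fin_cases i <;> simp
  have hc : HasSubst (![h * (X 0 - X 1), X 2] : Fin 2 → P) :=
    hasSubst_of_constantCoeff_zero fun i ↦ by fin_cases i <;> simp
  let σ₁ : P →ₐ[K] R := substAlgHom ha₁
  let σ₂ : P →ₐ[K] R := substAlgHom ha₂
  let τ : R →ₐ[K] P := substAlgHom hc
  have σ₁_X0 : σ₁ (X 0) = 2 * X 0 := substAlgHom_X ha₁ 0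
  have σ₁_X1 : σ₁ (X 1) = 0 := substAlgHom_X ha₁ 1
  have σ₁_X2 : σ₁ (X 2) = X 1 := substAlgHom_X ha₁ 2
  have σ₂_X0 : σ₂ (X 0) = 0 := substAlgHom_X ha₂ 0
  have σ₂_X1 : σ₂ (X 1) = -(2 * X 0) := substAlgHom_X ha₂ 1
  have σ₂_X2 : σ₂ (X 2) = X 1 := substAlgHom_X ha₂ 2
  have τ_X0 : τ (X 0) = h * (X 0 - X 1) := substAlgHom_X hc 0
  have τ_X1 : τ (X 1) = X 2 := substAlgHom_X hc 1
  have hστ : ∀ (φ : P →ₐ[K] R) {a : Fin 3 → R} (ha : HasSubst a), φ = substAlgHom ha →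
      φ (τ (X 0)) = X 0 → φ (τ (X 1)) = X 1 → ∀ g, φ (τ g) = g := by
    rintro φ a ha rfl h0 h1 g
    have := substAlgHom_comp_substAlgHom_apply hc ha g
    simp only [τ]
    rw [this, substAlgHom_apply]
    conv_rhs => rw [← id_eq g, ← subst_self]
    congr 1
    funext i
    fin_cases i
    · rwa [τ_X0] at h0
    · rwa [τ_X1] at h1
  have hσ₁τ : ∀ g, σ₁ (τ g) = g := hστ σ₁ ha₁ rfl
    (by rw [τ_X0, map_mul, map_sub, σ₁_X0, σ₁_X1, hmap]; linear_combination X 0 * hh R)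
    (by rw [τ_X1, σ₁_X2])
  have hσ₂τ : ∀ g, σ₂ (τ g) = g := hστ σ₂ ha₂ rfl
    (by rw [τ_X0, map_mul, map_sub, σ₂_X0, σ₂_X1, hmap]; linear_combination X 0 * hh R)
    (by rw [τ_X1, σ₂_X2])
  have hX2 : (2 * X 0 : R) ≠ 0 := by
    have h2 : (2 : R) ≠ 0 := fun h2 ↦ by simpa [h2] using hh R
    have hX : (X 0 : R) ≠ 0 := fun hX ↦ by
      simpa [coeff_X] using congrArg (coeff (Finsupp.single (0 : Fin 2) 1)) hX
    exact mul_ne_zero h2 hX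
  have hker : ∀ f : P, σ₁ f = 0 → σ₂ f = 0 → f ∈ I := by
    have hd₁ : HasSubst (![h * X 0, X 2] : Fin 2 → P) :=
      hasSubst_of_constantCoeff_zero fun i ↦ by fin_cases i <;> simp
    have hd₂ : HasSubst (![-(h * X 1), X 2] : Fin 2 → P) :=
      hasSubst_of_constantCoeff_zero fun i ↦ by fin_cases i <;> simp
    intro f hf₁ hf₂
    obtain ⟨g, rfl⟩ := X_dvd_of_substAlgHom_eq_zero ha₁ hd₁ 1 rfl (fun i hi ↦ by
      fin_cases i
      · change substAlgHom hd₁ (2 * X 0) = X 0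
        rw [map_mul, map_ofNat, substAlgHom_X]
        change 2 * (h * X 0) = (X 0 : P)
        linear_combination X 0 * hh P
      · simp at hi
      · exact substAlgHom_X hd₁ 1) hf₁
    rw [map_mul, σ₂_X1, mul_eq_zero] at hf₂
    have hg := hf₂.resolve_left (neg_ne_zero.2 hX2)
    obtain ⟨g, rfl⟩ := X_dvd_of_substAlgHom_eq_zero ha₂ hd₂ 0 rfl (fun i hi ↦ by
      fin_cases i
      · simp at hi
      · change substAlgHom hd₂ (-(2 * X 0)) = X 1
        rw [map_neg, map_mul, map_ofNat, substAlgHom_X]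
        change -(2 * -(h * X 1)) = (X 1 : P)
        linear_combination X 1 * hh P
      · exact substAlgHom_X hd₂ 1) hg
    rw [← mul_assoc, mul_comm (X 1)]
    exact I.mul_mem_right _ (Ideal.subset_span (by simp))
  have hdvd : ∀ f : P, ∃ b : R, σ₁ f - σ₂ f = 2 * X 0 * b := by
    intro f
    have hρ := HasSubst.update_X_zero (K := K) (0 : Fin 2)
    have hρσ : substAlgHom (R := K) hρ (σ₁ f) = substAlgHom hρ (σ₂ f) := by
      simp only [σ₁, σ₂]
      rw [substAlgHom_comp_substAlgHom_apply, substAlgHom_comp_substAlgHom_apply,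
        substAlgHom_apply, substAlgHom_apply]
      congr 1
      funext i
      have h0 : substAlgHom (R := K) hρ (2 * X 0) = 0 := by
        rw [map_mul, substAlgHom_X, Function.update_self, mul_zero]
      fin_cases i
      · exact h0.trans (map_zero _).symm
      · refine (map_zero _).trans ?_
        change 0 = substAlgHom (R := K) hρ (-(2 * X 0))
        rw [map_neg, h0, neg_zero]
      · rfl
    rw [substAlgHom_apply hρ, substAlgHom_apply hρ] at hρσ
    obtain ⟨b, hb⟩ := dvd_sub (X_dvd_sub_subst_update_zero 0 (σ₁ f))
      (X_dvd_sub_subst_update_zero 0 (σ₂ f))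
    rw [hρσ, sub_sub_sub_cancel_right] at hb
    exact ⟨h * b, by linear_combination hb - X 0 * b * hh R⟩
  choose B hB using hdvd
  let A : P → R := fun f ↦ h * (σ₁ f + σ₂ f)
  have hA₁ : ∀ f, σ₁ f = A f + B f * X 0 := fun f ↦ by
    simp only [A]
    linear_combination h * hB f - (σ₁ f - B f * X 0) * hh R
  have hA₂ : ∀ f, σ₂ f = A f - B f * X 0 := fun f ↦ by
    simp only [A]
    linear_combination -h * hB f - (σ₂ f + B f * X 0) * hh R
  have huniq : ∀ f a b, σ₁ f = a + b * X 0 → σ₂ f = a - b * X 0 → A f = a ∧ B f = b := by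
    intro f a b h₁ h₂
    refine ⟨?_, mul_left_cancel₀ hX2 ?_⟩
    · simp only [A]
      rw [h₁, h₂]
      linear_combination a * hh R
    · rw [← hB, h₁, h₂]
      ring
  let mkJ : Polynomial R →ₐ[K] Polynomial R ⧸ J := Ideal.Quotient.mkₐ K J
  let G : P → Polynomial R := fun f ↦ Polynomial.C (A f) + Polynomial.C (B f) * Polynomial.X
  have hG : ∀ f a b, σ₁ f = a + b * X 0 → σ₂ f = a - b * X 0 →
      G f = Polynomial.C a + Polynomial.C b * Polynomial.X := by
    intro f a b h₁ h₂
    simp only [G, huniq f a b h₁ h₂]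
  have hGalg : ∀ r : K, G (algebraMap K P r) = algebraMap K (Polynomial R) r := fun r ↦ by
    rw [hG _ (algebraMap K R r) 0 (by simp) (by simp)]
    simp [IsScalarTower.algebraMap_apply K R (Polynomial R)]
  have hGmul : ∀ f g, G f * G g - G (f * g) ∈ J := fun f g ↦ by
    rw [hG (f * g) (A f * A g + B f * B g * X 0 ^ 2) (A f * B g + A g * B f)
      (by rw [map_mul, hA₁, hA₁]; ring) (by rw [map_mul, hA₂, hA₂]; ring)]
    have : (Polynomial.X ^ 2 - Polynomial.C (X 0) ^ 2 : Polynomial R) ∈ J :=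
      Ideal.subset_span (by simp)
    convert J.mul_mem_left (Polynomial.C (B f) * Polynomial.C (B g)) this using 1
    simp only [G, map_add, map_mul, map_pow]
    ring
  let F : P →ₐ[K] Polynomial R ⧸ J :=
    { toFun := fun f ↦ mkJ (G f)
      map_one' := by
        rw [← map_one (algebraMap K P), hGalg, map_one, map_one]
      map_mul' := fun f g ↦ by
        rw [← map_mul]
        exact (Ideal.Quotient.eq.2 (hGmul f g)).symm
      map_zero' := by
        rw [← map_zero (algebraMap K P), hGalg, map_zero, map_zero]
      map_add' := fun f g ↦ by
        rw [← map_add, hG (f + g) (A f + A g) (B f + B g)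
          (by rw [map_add, hA₁, hA₁]; ring) (by rw [map_add, hA₂, hA₂]; ring)]
        simp only [G, map_add, add_mul]
        abel
      commutes' := fun r ↦ by
        rw [hGalg, AlgHom.commutes] }
  have hF : ∀ f, F f = mkJ (G f) := fun f ↦ rfl
  have hF0 : F (X 0) = mkJ (Polynomial.X + Polynomial.C (X 0)) := by
    rw [hF, hG (X 0) (X 0) 1 (by rw [σ₁_X0]; ring) (by rw [σ₂_X0]; ring), map_one, one_mul, add_comm]
  have hF1 : F (X 1) = mkJ (Polynomial.X - Polynomial.C (X 0)) := by
    rw [hF, hG (X 1) (-X 0) 1 (by rw [σ₁_X1]; ring) (by rw [σ₂_X1]; ring), map_one, one_mul, map_neg,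
      neg_add_eq_sub]
  have hF2 : F (X 2) = mkJ (Polynomial.C (X 1)) := by
    rw [hF, hG (X 2) (X 1) 0 (by rw [σ₁_X2]; ring) (by rw [σ₂_X2]; ring), map_zero, zero_mul, add_zero]
  have hFI : ∀ f ∈ I, F f = 0 := by
    suffices I ≤ RingHom.ker F from fun f hf ↦ this hf
    rw [hI, Ideal.span_le]
    rintro _ (rfl | rfl)
    · rw [SetLike.mem_coe, RingHom.mem_ker, map_mul, hF0, hF1, ← map_mul]
      refine Ideal.Quotient.eq_zero_iff_mem.2 (Ideal.subset_span (Or.inr ?_))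
      rw [Set.mem_singleton_iff]
      ring
    · rw [SetLike.mem_coe, RingHom.mem_ker, map_mul, map_sub, hF0, hF1, hF2, ← map_sub, ← map_mul]
      refine Ideal.Quotient.eq_zero_iff_mem.2 ?_
      have : (Polynomial.C (X 0 * X 1) : Polynomial R) ∈ J := Ideal.subset_span (by simp)
      convert J.mul_mem_left 2 this using 1
      rw [map_mul]
      ring
  let θ : Polynomial R →ₐ[K] P :=
    { Polynomial.eval₂RingHom (τ : R →+* P) (h * (X 0 + X 1)) with
      commutes' := fun r ↦ by
        simp [IsScalarTower.algebraMap_apply K R (Polynomial R)] }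
  have θC : ∀ g, θ (Polynomial.C g) = τ g := fun g ↦
    Polynomial.eval₂_C (τ : R →+* P) (h * (X 0 + X 1))
  have θX : θ Polynomial.X = h * (X 0 + X 1) :=
    Polynomial.eval₂_X (τ : R →+* P) (h * (X 0 + X 1))
  let mkI : P →ₐ[K] P ⧸ I := Ideal.Quotient.mkₐ K I
  have hθJ : ∀ p ∈ J, (mkI.comp θ) p = 0 := by
    suffices J ≤ RingHom.ker (mkI.comp θ) from fun f hf ↦ this hf
    rw [hJ, Ideal.span_le]
    have h01 : (X 0 * X 1 : P) ∈ I := Ideal.subset_span (by simp)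
    have h02 : ((X 0 - X 1) * X 2 : P) ∈ I := Ideal.subset_span (by simp)
    rintro _ (rfl | rfl)
    · refine Ideal.Quotient.eq_zero_iff_mem.2 ?_
      change θ _ ∈ I
      rw [θC, map_mul, τ_X0, τ_X1, mul_assoc]
      exact I.mul_mem_left _ h02
    · refine Ideal.Quotient.eq_zero_iff_mem.2 ?_
      change θ _ ∈ I
      rw [map_sub, map_pow, map_pow, θC, θX, τ_X0]
      convert I.mul_mem_left (4 * h ^ 2) h01 using 1
      ring
  have hθG : ∀ f, mkI (θ (G f)) = mkI f := fun f ↦ by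
    refine Ideal.Quotient.eq.2 (hker _ ?_ ?_)
    · simp only [G, map_sub, map_add, map_mul, θC, θX, hσ₁τ, hmap, σ₁_X0, σ₁_X1, hA₁ f]
      linear_combination B f * X 0 * hh R
    · simp only [G, map_sub, map_add, map_mul, θC, θX, hσ₂τ, hmap, σ₂_X0, σ₂_X1, hA₂ f]
      linear_combination -B f * X 0 * hh R
  have hFθ : F.comp θ = mkJ := by
    refine Polynomial.algHom_ext' (AlgHom.ext fun g ↦ ?_) ?_
    · change F (θ (Polynomial.C g)) = mkJ (Polynomial.C g)
      rw [θC, hF, hG (τ g) g 0 (by rw [hσ₁τ]; ring) (by rw [hσ₂τ]; ring), map_zero, zero_mul,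
        add_zero]
    · rw [AlgHom.comp_apply, θX, map_mul, map_add, hF0, hF1, ← map_add,
        show F h = mkJ h from (F.commutes _).trans (mkJ.commutes _).symm, ← map_mul]
      congr 1
      linear_combination Polynomial.X * hh (Polynomial R)
  refine ⟨AlgEquiv.ofAlgHom (Ideal.Quotient.liftₐ I F hFI)
    (Ideal.Quotient.liftₐ J (mkI.comp θ) hθJ) ?_ ?_, hF0, hF1, hF2⟩
  · refine Ideal.Quotient.algHom_ext _ (AlgHom.ext fun p ↦ ?_)
    exact DFunLike.congr_fun hFθ p
  · refine Ideal.Quotient.algHom_ext _ (AlgHom.ext fun f ↦ ?_)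
    exact hθG f
end
end
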